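/- Let T and M be positive integers with T ≥ 2M. Then the Lebesgue integral over ℂ^{(T−M)×M} of the function Ã ↦ det(I_M + Ã^H Ã)^{−T} is finite and equals π^{M(T−M)} ∏_{m=1}^{M} (m−1)! / (T−m)!, i.e. π^{M(T−M)} · 1!·2!⋯(M−1)! / [(T−M)!·(T−M+1)!⋯(T−1)!] — the volume of the complex Grassmannian Gr(M, ℂ^T). -/

import Mathlib

open Matrix MeasureTheory

noncomputable instance {m n : ℕ} : MeasureSpace (Matrix (Fin m) (Fin n) ℂ) := by
  unfold Matrix; infer_instance

open Set Filter Topology in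
/-- The radial integral. -/
lemma grass_radial (a : ℝ) (ha : 0 < a) (k : ℕ) :
    ∫⁻ r in Ioi (0:ℝ), ENNReal.ofReal (r * ((a + r ^ 2) ^ (k + 2))⁻¹)
      = ENNReal.ofReal (1 / (2 * (k + 1)) * (a ^ (k + 1))⁻¹) := by
  have hd : ∀ x ∈ Ici (0:ℝ), HasDerivAt (fun r : ℝ => -(1 / (2 * ((k:ℝ) + 1))) * ((a + r ^ 2) ^ (k + 1))⁻¹)
      (x * ((a + x ^ 2) ^ (k + 2))⁻¹) x := by
    intro x _
    have hpos : a + x ^ 2 ≠ 0 := by positivity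
    have h1 : HasDerivAt (fun r : ℝ => a + r ^ 2) (2 * x) x := by
      simpa using (hasDerivAt_pow 2 x).const_add a
    have h2 := ((h1.pow (k + 1)).inv (pow_ne_zero _ hpos)).const_mul (-(1 / (2 * ((k:ℝ) + 1))))
    refine h2.congr_deriv ?_
    have : (k:ℝ) + 1 ≠ 0 := by positivity
    push_cast
    field_simp
    simp [pow_add]
    try field_simp
    try ring
  have hpos : ∀ x ∈ Ioi (0:ℝ), 0 ≤ x * ((a + x ^ 2) ^ (k + 2))⁻¹ := by
    intro x hx
    have : (0:ℝ) < x := hx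
    positivity
  have hlim : Tendsto (fun r : ℝ => -(1 / (2 * ((k:ℝ) + 1))) * ((a + r ^ 2) ^ (k + 1))⁻¹) atTop (𝓝 0) := by
    have h1 : Tendsto (fun r : ℝ => (a + r ^ 2) ^ (k + 1)) atTop atTop :=
      (tendsto_pow_atTop (by omega)).comp
        (tendsto_atTop_add_const_left _ _ (tendsto_pow_atTop (by norm_num)))
    simpa using (tendsto_inv_atTop_zero.comp h1).const_mul (-(1 / (2 * ((k:ℝ) + 1))))
  rw [← ofReal_integral_eq_lintegral_ofReal (integrableOn_Ioi_deriv_of_nonneg' hd hpos hlim)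
    ((ae_restrict_iff' measurableSet_Ioi).2 (Eventually.of_forall hpos)),
    integral_Ioi_of_hasDerivAt_of_nonneg' hd hpos hlim]
  simp

open Set in
lemma grass_one (a : ℝ) (ha : 0 < a) (k : ℕ) :
    ∫⁻ z : ℂ, ENNReal.ofReal (((a + ‖z‖ ^ 2) ^ (k + 2))⁻¹)
      = ENNReal.ofReal (Real.pi / (k + 1) * (a ^ (k + 1))⁻¹) := by
  rw [← Complex.lintegral_comp_polarCoord_symm, polarCoord_target]
  have : ∀ p : ℝ × ℝ, p ∈ Ioi (0:ℝ) ×ˢ Ioo (-Real.pi) Real.pi →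
      ENNReal.ofReal p.1 • ENNReal.ofReal (((a + ‖Complex.polarCoord.symm p‖ ^ 2) ^ (k + 2))⁻¹)
      = ENNReal.ofReal (p.1 * ((a + p.1 ^ 2) ^ (k + 2))⁻¹) * 1 := by
    rintro p ⟨hp, -⟩
    have : (0:ℝ) < p.1 := hp
    rw [Complex.norm_polarCoord_symm, sq_abs, smul_eq_mul, mul_one, ENNReal.ofReal_mul this.le]
  rw [setLIntegral_congr_fun (measurableSet_Ioi.prod measurableSet_Ioo) this,
    Measure.volume_eq_prod, ← Measure.prod_restrict,
    lintegral_prod_mul (f := fun r : ℝ => ENNReal.ofReal (r * ((a + r ^ 2) ^ (k + 2))⁻¹))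
      (g := fun _ => 1) (by fun_prop) (by fun_prop), grass_radial a ha k]
  have hpi := Real.pi_pos
  simp only [lintegral_const, Measure.restrict_apply MeasurableSet.univ, univ_inter, Real.volume_Ioo,
    one_mul]
  rw [← ENNReal.ofReal_mul (by positivity)]
  congr 1
  field_simp
  ring

lemma grass_vec (n k : ℕ) : ∀ (a : ℝ), 0 < a →
    ∫⁻ v : Fin n → ℂ, ENNReal.ofReal (((a + ∑ i, ‖v i‖ ^ 2) ^ (n + k + 1))⁻¹)
      = ENNReal.ofReal (Real.pi ^ n * (Nat.factorial k / Nat.factorial (n + k)) * (a ^ (k + 1))⁻¹) := by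
  induction n with
  | zero =>
    intro a ha
    have : (Nat.factorial k : ℝ) ≠ 0 := by positivity
    rw [volume_pi, Measure.pi_of_empty, lintegral_dirac]
    simp [this]
  | succ n ih =>
    intro a ha
    have hpi := Real.pi_pos
    have e := (volume_preserving_piFinSuccAbove (fun _ : Fin (n + 1) => ℂ) 0)
    rw [← e.symm.lintegral_comp_emb (MeasurableEquiv.measurableEmbedding _),
      Measure.volume_eq_prod, lintegral_prod_symm' _ (by fun_prop)]
    have : ∀ w : Fin n → ℂ, ∫⁻ z : ℂ, ENNReal.ofReal
        (((a + ∑ i, ‖((MeasurableEquiv.piFinSuccAbove (fun _ : Fin (n + 1) => ℂ) 0).symm (z, w)) i‖ ^ 2)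
            ^ (n + 1 + k + 1))⁻¹)
        = ENNReal.ofReal (Real.pi / (n + k + 1)) *
          ENNReal.ofReal (((a + ∑ i, ‖w i‖ ^ 2) ^ (n + k + 1))⁻¹) := by
      intro w
      rw [← ENNReal.ofReal_mul (by positivity)]
      have h := grass_one (a + ∑ i, ‖w i‖ ^ 2) (by positivity) (n + k)
      push_cast at h
      rw [← h]
      congr 1; ext z
      congr 3
      · simp [MeasurableEquiv.piFinSuccAbove, Fin.sum_univ_succ]
        ring
      · ring
    simp only [this]
    rw [lintegral_const_mul _ (by fun_prop), ih a ha, ← ENNReal.ofReal_mul (by positivity)]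
    congr 1
    have : (n + 1 + k) = (n + k) + 1 := by ring
    rw [this, Nat.factorial_succ]
    push_cast
    field_simp
    ring

lemma grass_det (n : ℕ) (v : Fin n → ℂ) :
    (1 + vecMulVec (star v) v).det = ((1 + ∑ i, ‖v i‖ ^ 2 : ℝ) : ℂ) := by
  rw [vecMulVec_eq Unit, det_one_add_replicateCol_mul_replicateRow]
  simp [dotProduct, Complex.mul_conj, Complex.normSq_eq_norm_sq]

lemma grass_fac (n : ℕ) (L : Matrix (Fin n) (Fin n) ℂ) (u : Fin n → ℂ) :
    Lᴴ * L + vecMulVec (star (Lᵀ *ᵥ u)) (Lᵀ *ᵥ u) = Lᴴ * (1 + vecMulVec (star u) u) * L := by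
  rw [Matrix.mul_add, Matrix.add_mul, Matrix.mul_one, mul_vecMulVec, vecMulVec_mul, 
    mulVec_transpose, star_vecMul]

open scoped MatrixOrder ComplexOrder in
lemma grass_lin (n k : ℕ) (K : Matrix (Fin n) (Fin n) ℂ) (hK : K.PosDef) :
    ∫⁻ v : Fin n → ℂ, ENNReal.ofReal (((K + vecMulVec (star v) v).det.re ^ (n + k + 1))⁻¹)
      = ENNReal.ofReal (Real.pi ^ n * (Nat.factorial k / Nat.factorial (n + k))
          * (K.det.re ^ (n + k))⁻¹) := by
  obtain ⟨L, hL, rfl⟩ := CStarAlgebra.isStrictlyPositive_iff_eq_star_mul_self.mp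
        hK.isStrictlyPositive
  have hL' : L.det ≠ 0 := by
    rw [Matrix.isUnit_iff_isUnit_det] at hL
    exact hL.ne_zero
  set d := Complex.normSq L.det with hd
  have hd0 : 0 < d := Complex.normSq_pos.2 hL'
  have hdet : (star L * L).det = (d : ℂ) := by
    rw [star_eq_conjTranspose, det_mul, det_conjTranspose, hd, Complex.normSq_eq_conj_mul_self]
    rfl
  let f : (Fin n → ℂ) →ₗ[ℝ] (Fin n → ℂ) := (Matrix.toLin' Lᵀ).restrictScalars ℝ
  have hf : LinearMap.det f = d := by
    simp only [f]
    rw [LinearMap.det_restrictScalars, LinearMap.det_toLin', det_transpose,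
      Algebra.norm_complex_apply]
  have hmap := Measure.map_linearMap_addHaar_eq_smul_addHaar
    (volume : Measure (Fin n → ℂ)) (f := f) (by rw [hf]; exact hd0.ne')
  have hfm : Measurable f := (LinearMap.continuous_of_finiteDimensional f).measurable
  set F : (Fin n → ℂ) → ENNReal :=
    fun v => ENNReal.ofReal (((star L * L + vecMulVec (star v) v).det.re ^ (n + k + 1))⁻¹) with hF
  have hFm : Measurable F := by
    have : Measurable (fun v : Fin n → ℂ => (star L * L + vecMulVec (star v) v).det.re) := by
      apply Continuous.measurable
      apply Complex.continuous_re.comp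
      apply Continuous.matrix_det
      apply continuous_const.add
      exact Continuous.matrix_vecMulVec continuous_star continuous_id
    fun_prop
  have h1 : ∫⁻ u, F (f u) = ENNReal.ofReal d⁻¹ * ∫⁻ v, F v := by
    rw [← lintegral_map hFm hfm, hmap, lintegral_smul_measure, hf, abs_of_pos (by positivity)]
    rfl
  have h2 : ∫⁻ u, F (f u) = ENNReal.ofReal ((d ^ (n + k + 1))⁻¹) *
      ENNReal.ofReal (Real.pi ^ n * (Nat.factorial k / Nat.factorial (n + k))) := by
    have := grass_vec n k 1 one_pos
    simp only [one_pow, inv_one, mul_one] at this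
    rw [← this, ← lintegral_const_mul _ (by fun_prop)]
    congr 1; ext u
    rw [← ENNReal.ofReal_mul (by positivity), ← mul_inv, ← mul_pow]
    simp only [hF, f, LinearMap.restrictScalars_apply, Matrix.toLin'_apply, star_eq_conjTranspose]
    rw [grass_fac, det_mul, det_mul, mul_right_comm, ← det_mul, ← star_eq_conjTranspose, hdet,
      grass_det, ← Complex.ofReal_mul, Complex.ofReal_re]
  have hpi := Real.pi_pos
  have h3 : ∫⁻ v, F v = ENNReal.ofReal d * (ENNReal.ofReal d⁻¹ * ∫⁻ v, F v) := by
    rw [← mul_assoc, ← ENNReal.ofReal_mul hd0.le, mul_inv_cancel₀ hd0.ne', ENNReal.ofReal_one,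
      one_mul]
  rw [h3, ← h1, h2, hdet, Complex.ofReal_re, ← ENNReal.ofReal_mul (by positivity),
    ← ENNReal.ofReal_mul (by positivity)]
  congr 1
  field_simp
  ring

open scoped ComplexOrder in
lemma grass_posDef (N M : ℕ) (A : Matrix (Fin N) (Fin M) ℂ) : (1 + Aᴴ * A).PosDef :=
  Matrix.PosDef.one.add_posSemidef (posSemidef_conjTranspose_mul_self A)

lemma grass_cons (N M : ℕ) (v : Fin M → ℂ) (A : Fin N → Fin M → ℂ) :
    (1 + (Matrix.of (Fin.cons v A : Fin (N + 1) → Fin M → ℂ))ᴴ * Matrix.of (Fin.cons v A : Fin (N + 1) → Fin M → ℂ))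
     = 1 + (Matrix.of A)ᴴ * Matrix.of A + vecMulVec (star v) v := by
  ext i j
  simp [Matrix.mul_apply, Fin.sum_univ_succ, vecMulVec_apply]
  ring

lemma grass_meas (N M p : ℕ) : Measurable (fun A : Fin N → Fin M → ℂ =>
    ENNReal.ofReal ((((1 + (Matrix.of A)ᴴ * Matrix.of A).det).re ^ p)⁻¹)) := by
  have : Measurable (fun A : Fin N → Fin M → ℂ => (1 + (Matrix.of A)ᴴ * Matrix.of A).det.re) := by
    apply Continuous.measurable
    apply Complex.continuous_re.comp
    apply Continuous.matrix_det
    apply continuous_const.add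
    have : Continuous (fun A : Fin N → Fin M → ℂ => (Matrix.of A)) := continuous_id
    exact this.matrix_conjTranspose.matrix_mul this
  fun_prop

lemma grass_main (N M : ℕ) :
    ∫⁻ A : Fin N → Fin M → ℂ,
        ENNReal.ofReal ((((1 + (Matrix.of A)ᴴ * Matrix.of A).det).re ^ (M + N))⁻¹)
      = ENNReal.ofReal (Real.pi ^ (M * N) *
          ∏ m ∈ Finset.range N, (Nat.factorial m : ℝ) / (Nat.factorial (M + m) : ℝ)) := by
  have hpi := Real.pi_pos
  induction N with
  | zero =>
    rw [volume_pi, Measure.pi_of_empty, lintegral_dirac]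
    have : ∀ A : Matrix (Fin 0) (Fin M) ℂ, Aᴴ * A = 0 := by
      intro A; ext i j; simp [Matrix.mul_apply]
    simp [this]
  | succ N ih =>
    have e := (volume_preserving_piFinSuccAbove (fun _ : Fin (N + 1) => Fin M → ℂ) 0)
    rw [← e.symm.lintegral_comp_emb (MeasurableEquiv.measurableEmbedding _),
      Measure.volume_eq_prod, lintegral_prod_symm' _ (by
        exact (grass_meas (N + 1) M (M + (N + 1))).comp (MeasurableEquiv.measurable _))]
    have : ∀ A : Fin N → Fin M → ℂ, ∫⁻ v : Fin M → ℂ, ENNReal.ofReal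
        ((((1 + (Matrix.of ((MeasurableEquiv.piFinSuccAbove (fun _ : Fin (N + 1) => Fin M → ℂ) 0).symm (v, A)))ᴴ
          * Matrix.of ((MeasurableEquiv.piFinSuccAbove (fun _ : Fin (N + 1) => Fin M → ℂ) 0).symm (v, A))).det).re ^ (M + (N + 1)))⁻¹)
        = ENNReal.ofReal (Real.pi ^ M * (Nat.factorial N / Nat.factorial (M + N))) *
          ENNReal.ofReal ((((1 + (Matrix.of A)ᴴ * Matrix.of A).det).re ^ (M + N))⁻¹) := by
      intro A
      rw [← ENNReal.ofReal_mul (by positivity), ← grass_lin M N _ (grass_posDef _ _ _)]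
      congr 1; ext v
      rw [← grass_cons]
      have : (MeasurableEquiv.piFinSuccAbove (fun _ : Fin (N + 1) => Fin M → ℂ) 0).symm (v, A)
          = (Fin.cons v A : Fin (N + 1) → Fin M → ℂ) := by
        simp [MeasurableEquiv.piFinSuccAbove]
        rfl
      rw [this]
      rfl
    simp only [this]
    rw [lintegral_const_mul _ (grass_meas _ _ _), ih, ← ENNReal.ofReal_mul (by positivity)]
    congr 1
    rw [Finset.prod_range_succ]
    ring

lemma grass_prod (N M : ℕ) :
    ∏ m ∈ Finset.range N, (Nat.factorial m : ℝ) / (Nat.factorial (M + m) : ℝ)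
      = ∏ m ∈ Finset.Icc 1 M, (Nat.factorial (m - 1) : ℝ) / (Nat.factorial (N + M - m) : ℝ) := by
  have h1 := Finset.prod_range_add (fun m => (Nat.factorial m : ℝ)) N M
  have h2 := Finset.prod_range_add (fun m => (Nat.factorial m : ℝ)) M N
  have h3 : ∏ m ∈ Finset.Icc 1 M, (Nat.factorial (m - 1) : ℝ) / (Nat.factorial (N + M - m) : ℝ)
    = (∏ m ∈ Finset.range M, (Nat.factorial m : ℝ)) / ∏ m ∈ Finset.range M, (Nat.factorial (N + m) : ℝ) := by
    rw [Finset.prod_div_distrib]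
    have hI : Finset.Icc 1 M = Finset.Ico 1 (M + 1) := by ext; simp
    rw [hI, Finset.prod_Ico_eq_prod_range, Finset.prod_Ico_eq_prod_range]
    congr 1
    · refine Finset.prod_congr rfl fun i _ => by simp
    · rw [← Finset.prod_range_reflect]
      refine Finset.prod_congr (by simp) fun i hi => ?_
      simp only [Finset.mem_range] at hi
      congr 2
      omega
  rw [h3, Finset.prod_div_distrib]
  rw [add_comm M N] at h2
  have p1 : (∏ m ∈ Finset.range M, (Nat.factorial (N + m) : ℝ)) ≠ 0 :=
    Finset.prod_ne_zero_iff.2 fun _ _ => by positivity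
  have p2 : (∏ m ∈ Finset.range N, (Nat.factorial (M + m) : ℝ)) ≠ 0 :=
    Finset.prod_ne_zero_iff.2 fun _ _ => by positivity
  rw [div_eq_div_iff p2 p1, ← h1, h2]

theorem volume_grassmannian
    (T M : ℕ) (hT : 0 < T) (hM : 0 < M) (hTM : 2 * M ≤ T) :
    ∫⁻ A : Matrix (Fin (T - M)) (Fin M) ℂ,
        ENNReal.ofReal ((((1 + Aᴴ * A).det).re ^ T)⁻¹)
      = ENNReal.ofReal (Real.pi ^ (M * (T - M)) *
          ∏ m ∈ Finset.Icc 1 M, (Nat.factorial (m - 1) : ℝ) / (Nat.factorial (T - m) : ℝ)) := by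
  obtain ⟨N, rfl⟩ : ∃ N, T = N + M := ⟨T - M, by omega⟩
  rw [← grass_prod, Nat.add_sub_cancel, ← grass_main, add_comm N M]
  rfl
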